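/- Let e_n(x) = (x_1+ix_2)^n on S^d, h_n = (n(n+d−1))^{−1/2}, E the equator {x ∈ S^d : x_3 = ... = x_{d+1} = 0}, and N_β = {x ∈ S^d : d(x,E) < β}. Then for any fixed 0 < δ < 1/2, there are constants C_1, C_2, c > 0 such that ‖e_n‖_{L²(N_{h_n^δ})} ≥ C_1 h_n^{(d−1)/4} and ‖e_n‖_{L²(N_{2h_n^δ} \ N_{h_n^δ})} ≤ C_2 e^{−c h_n^{2δ−1}} for all large n. -/

import Mathlib

set_option autoImplicit false

open MeasureTheory Complex
open scoped Pointwise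

/-- A quadratic upper bound for the cosine on the unit interval, read through `arccos`. -/
lemma le_one_sub_sq_div_eight_of_le_arccos {r β : ℝ} (hr0 : 0 ≤ r) (hr1 : r ≤ 1)
    (hβ0 : 0 ≤ β) (hβ1 : β ≤ 1) (h : β ≤ Real.arccos r) : r ≤ 1 - β ^ 2 / 8 := by
  have hπ3 := Real.pi_gt_three
  have hπ4 := Real.pi_le_four
  have h1 : r ≤ Real.cos β := by
    rw [← Real.cos_arccos (by linarith) hr1]
    exact Real.cos_le_cos_of_nonneg_of_le_pi hβ0 (Real.arccos_le_pi r) h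
  have h2 := Real.cos_le_one_sub_mul_cos_sq (x := β) (by rw [abs_of_nonneg hβ0]; linarith)
  have h3 : (1 : ℝ) / 8 ≤ 2 / Real.pi ^ 2 := by
    rw [div_le_div_iff₀ (by norm_num) (by positivity)]
    nlinarith
  nlinarith [sq_nonneg β]

lemma one_sub_sq_div_two_le_of_arccos_lt {r β : ℝ} (hr0 : 0 ≤ r) (hr1 : r ≤ 1)
    (h : Real.arccos r < β) : 1 - β ^ 2 / 2 ≤ r := by
  have h1 := Real.one_sub_sq_div_two_le_cos (x := Real.arccos r)
  rw [Real.cos_arccos (by linarith) hr1] at h1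
  nlinarith [Real.arccos_nonneg r]

lemma one_fourth_le_pow_of_arccos_lt {r β : ℝ} {n : ℕ} (hn : 1 ≤ n) (hr0 : 0 ≤ r) (hr1 : r ≤ 1)
    (hβ : (n : ℝ) * β ^ 2 ≤ 1) (h : Real.arccos r < β) : 1 / 4 ≤ r ^ (2 * n) := by
  have h1 := one_sub_sq_div_two_le_of_arccos_lt hr0 hr1 h
  have hn' : (1 : ℝ) ≤ n := by exact_mod_cast hn
  have h2 : 1 + (n : ℝ) * (r - 1) ≤ (1 + (r - 1)) ^ n :=
    one_add_mul_le_pow (by linarith) n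
  rw [add_sub_cancel] at h2
  have h3 : 1 / 2 ≤ r ^ n := by nlinarith
  rw [mul_comm, pow_mul]
  nlinarith

lemma pow_le_exp_of_le_arccos {r β : ℝ} (n : ℕ) (hr0 : 0 ≤ r) (hr1 : r ≤ 1)
    (hβ0 : 0 ≤ β) (hβ1 : β ≤ 1) (h : β ≤ Real.arccos r) :
    r ^ (2 * n) ≤ Real.exp (-(n * β ^ 2 / 4)) := by
  have h1 := le_one_sub_sq_div_eight_of_le_arccos hr0 hr1 hβ0 hβ1 h
  have h2 : r ≤ Real.exp (-(β ^ 2 / 8)) := by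
    linarith [Real.add_one_le_exp (-(β ^ 2 / 8))]
  calc r ^ (2 * n) ≤ Real.exp (-(β ^ 2 / 8)) ^ (2 * n) := by gcongr
    _ = Real.exp (-(n * β ^ 2 / 4)) := by
      rw [← Real.exp_nat_mul]
      congr 1
      push_cast
      ring

lemma sqrt_sq_add_sq_le_norm {m : ℕ} (y : EuclideanSpace ℝ (Fin (m + 2))) :
    √(y 0 ^ 2 + y 1 ^ 2) ≤ ‖y‖ := by
  apply Real.sqrt_le_iff.2 ⟨norm_nonneg _, ?_⟩
  rw [EuclideanSpace.real_norm_sq_eq, Fin.sum_univ_succ, Fin.sum_univ_succ]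
  have : 0 ≤ ∑ i : Fin m, y i.succ.succ ^ 2 := Finset.sum_nonneg fun _ _ => sq_nonneg _
  simp only [Fin.succ_zero_eq_one]
  linarith

/-- A box around a segment of the first coordinate axis, thin in all directions but the first
two, is contained in the cone over the `ε`-neighbourhood of the equator. -/
lemma mem_cone_of_mem_Ioo {m : ℕ} {ε : ℝ} (hε0 : 0 < ε) (hε1 : ε ≤ 1) {a : ℝ}
    (ham : m * a ^ 2 ≤ 1 / 64) (y : EuclideanSpace ℝ (Fin (m + 2)))
    (h0 : y 0 ∈ Set.Ioo (1 / 2 : ℝ) (3 / 4)) (h1 : y 1 ∈ Set.Ioo (-(1 / 4) : ℝ) (1 / 4))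
    (hy : ∀ i : Fin m, y i.succ.succ ∈ Set.Ioo (-(a * ε)) (a * ε)) :
    y ∈ Set.Ioo (0 : ℝ) 1 • ((↑) '' {x : Metric.sphere (0 : EuclideanSpace ℝ (Fin (m + 2))) 1 |
      Real.arccos √((x : EuclideanSpace ℝ (Fin (m + 2))) 0 ^ 2 +
        (x : EuclideanSpace ℝ (Fin (m + 2))) 1 ^ 2) < ε} :
        Set (EuclideanSpace ℝ (Fin (m + 2)))) := by
  obtain ⟨h0l, h0u⟩ := h0
  obtain ⟨h1l, h1u⟩ := h1
  have hnorm : ‖y‖ ^ 2 = y 0 ^ 2 + y 1 ^ 2 + ∑ i : Fin m, y i.succ.succ ^ 2 := by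
    rw [EuclideanSpace.real_norm_sq_eq, Fin.sum_univ_succ, Fin.sum_univ_succ, ← add_assoc]
    rfl
  have hρ : ∑ i : Fin m, y i.succ.succ ^ 2 ≤ ε ^ 2 / 64 := by
    calc ∑ i : Fin m, y i.succ.succ ^ 2 ≤ ∑ _i : Fin m, (a * ε) ^ 2 :=
          Finset.sum_le_sum fun i _ => sq_le_sq' (hy i).1.le (hy i).2.le
      _ = m * a ^ 2 * ε ^ 2 := by simp; ring
      _ ≤ 1 / 64 * ε ^ 2 := by gcongr
      _ = ε ^ 2 / 64 := by ring
  have hρ0 : 0 ≤ ∑ i : Fin m, y i.succ.succ ^ 2 := Finset.sum_nonneg fun _ _ => sq_nonneg _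
  have hN0 : 0 < ‖y‖ := by
    apply norm_pos_iff.2
    rintro rfl
    norm_num at h0l
  have hN1 : ‖y‖ < 1 := by nlinarith
  have hunit : ‖‖y‖⁻¹ • y‖ = 1 := by
    rw [norm_smul, norm_inv, norm_norm, inv_mul_cancel₀ hN0.ne']
  refine Set.mem_smul.2 ⟨‖y‖, ⟨hN0, hN1⟩, ‖y‖⁻¹ • y,
    ⟨⟨‖y‖⁻¹ • y, by simpa using hunit⟩, ?_, rfl⟩, by rw [smul_inv_smul₀ hN0.ne']⟩
  have hr1 := sqrt_sq_add_sq_le_norm (‖y‖⁻¹ • y)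
  rw [hunit] at hr1
  simp only [Set.mem_ofPred_eq]
  set s := (‖y‖⁻¹ • y) 0 ^ 2 + (‖y‖⁻¹ • y) 1 ^ 2 with hs
  have hs0 : 0 ≤ s := by positivity
  have hsN : s * ‖y‖ ^ 2 = y 0 ^ 2 + y 1 ^ 2 := by
    simp only [hs, PiLp.smul_apply, smul_eq_mul]
    field_simp
  have hss : s ≤ √s := by nlinarith [Real.sq_sqrt hs0, Real.sqrt_nonneg s]
  by_contra! hcon
  have h2 := le_one_sub_sq_div_eight_of_le_arccos (Real.sqrt_nonneg s) hr1 hε0.le hε1 hcon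
  have h3 : s ≤ 1 - ε ^ 2 / 8 := hss.trans h2
  have h4 : s * ‖y‖ ^ 2 ≤ (1 - ε ^ 2 / 8) * ‖y‖ ^ 2 := by gcongr
  have h5 : 1 / 4 ≤ ‖y‖ ^ 2 := by nlinarith
  nlinarith [sq_pos_of_pos hε0]

lemma measurableSet_arccos_lt {m : ℕ} (ε : ℝ) :
    MeasurableSet {x : Metric.sphere (0 : EuclideanSpace ℝ (Fin (m + 2))) 1 |
      Real.arccos √((x : EuclideanSpace ℝ (Fin (m + 2))) 0 ^ 2 +
        (x : EuclideanSpace ℝ (Fin (m + 2))) 1 ^ 2) < ε} := by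
  apply IsOpen.measurableSet
  exact isOpen_lt (by fun_prop) continuous_const

/-- The `ε`-neighbourhood of the equator has surface measure at least a multiple of
`ε` to the codimension of the equator. -/
lemma exists_mul_pow_le_toSphere_real (m : ℕ) : ∃ C > (0 : ℝ), ∀ ε : ℝ, 0 < ε → ε ≤ 1 →
    C * ε ^ m ≤ (volume : Measure (EuclideanSpace ℝ (Fin (m + 2)))).toSphere.real
      {x | Real.arccos √((x : EuclideanSpace ℝ (Fin (m + 2))) 0 ^ 2 +
        (x : EuclideanSpace ℝ (Fin (m + 2))) 1 ^ 2) < ε} := by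
  obtain ⟨a, ha, ham⟩ : ∃ a > (0 : ℝ), m * a ^ 2 ≤ 1 / 64 := by
    refine ⟨1 / (8 * (m + 1)), by positivity, ?_⟩
    rw [div_pow, one_pow, mul_one_div, div_le_div_iff₀ (by positivity) (by norm_num)]
    nlinarith [sq_nonneg (m : ℝ), (Nat.cast_nonneg m : (0 : ℝ) ≤ m)]
  refine ⟨(2 * a) ^ m / 8, by positivity, fun ε hε0 hε1 => ?_⟩
  let lo : Fin (m + 2) → ℝ := Fin.cons (1 / 2) (Fin.cons (-(1 / 4)) fun _ => -(a * ε))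
  let hi : Fin (m + 2) → ℝ := Fin.cons (3 / 4) (Fin.cons (1 / 4) fun _ => a * ε)
  let B : Set (EuclideanSpace ℝ (Fin (m + 2))) :=
    WithLp.ofLp ⁻¹' (Set.univ.pi fun i => Set.Ioo (lo i) (hi i))
  have hB : volume B = ENNReal.ofReal ((2 * a) ^ m / 8 * ε ^ m) := by
    rw [(PiLp.volume_preserving_ofLp (Fin (m + 2))).measure_preimage
      (MeasurableSet.univ_pi fun _ => measurableSet_Ioo).nullMeasurableSet, Real.volume_pi_Ioo,
      ← ENNReal.ofReal_prod_of_nonneg]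
    · congr 1
      rw [Fin.prod_univ_succ, Fin.prod_univ_succ]
      simp only [lo, hi, Fin.cons_zero, Fin.cons_succ, Finset.prod_const, Finset.card_univ,
        Fintype.card_fin]
      rw [show a * ε - -(a * ε) = 2 * a * ε by ring, mul_pow (2 * a)]
      ring
    · intro i _
      refine Fin.cases ?_ (fun j => Fin.cases ?_ (fun k => ?_) j) i
      · norm_num [lo, hi]
      · norm_num [lo, hi]
      · have : 0 < a * ε := by positivity
        simp only [lo, hi, Fin.cons_succ]
        linarith
  rw [Measure.real, ← ENNReal.ofReal_le_iff_le_toReal (measure_ne_top _ _), ← hB,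
    Measure.toSphere_apply' _ (measurableSet_arccos_lt ε)]
  have hdim : (1 : ENNReal) ≤ (Module.finrank ℝ (EuclideanSpace ℝ (Fin (m + 2))) : ENNReal) := by
    rw [finrank_euclideanSpace_fin]
    exact_mod_cast Nat.succ_le_succ (Nat.zero_le _)
  refine le_trans (measure_mono fun y hy => ?_) (le_mul_of_one_le_left zero_le hdim)
  have hy' : ∀ i, y i ∈ Set.Ioo (lo i) (hi i) := fun i => hy i (Set.mem_univ i)
  exact mem_cone_of_mem_Ioo hε0 hε1 ham y (hy' 0) (hy' 1) fun i => hy' i.succ.succ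

/-- The semiclassical parameter is comparable to the inverse of the degree. -/
lemma rpow_neg_half_bounds {n d : ℕ} (hn : 1 ≤ n) (hd : 1 ≤ d) :
    let h : ℝ := ((n : ℝ) * ((n : ℝ) + (d : ℝ) - 1)) ^ (-(1 / 2 : ℝ))
    0 < h ∧ n * h ≤ 1 ∧ 1 ≤ d * (n * h) := by
  intro h
  have hn' : (1 : ℝ) ≤ n := by exact_mod_cast hn
  have hd' : (1 : ℝ) ≤ d := by exact_mod_cast hd
  have hq : 0 < (n : ℝ) * ((n : ℝ) + (d : ℝ) - 1) := by nlinarith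
  have hh : h = (√((n : ℝ) * ((n : ℝ) + (d : ℝ) - 1)))⁻¹ := by
    rw [Real.sqrt_eq_rpow, ← Real.rpow_neg hq.le]
  have hs : 0 < √((n : ℝ) * ((n : ℝ) + (d : ℝ) - 1)) := Real.sqrt_pos.2 hq
  rw [hh]
  refine ⟨by positivity, ?_, ?_⟩
  · rw [← div_eq_mul_inv, div_le_one hs]
    apply Real.le_sqrt_of_sq_le
    nlinarith
  · rw [← mul_assoc, ← div_eq_mul_inv, one_le_div hs, Real.sqrt_le_left (by positivity)]
    have h1 : (n : ℝ) + d - 1 ≤ d * n := by nlinarith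
    have h2 : (n : ℝ) * (n + d - 1) ≤ n * (d * n) := by gcongr
    have h3 : (n : ℝ) * (d * n) ≤ d * (n * (d * n)) := le_mul_of_one_le_left (by positivity) hd'
    nlinarith

/-- **Concentration of (x₁+ix₂)ⁿ near the equator.** On S^d with surface measure,
e_n(x) = (x₁+ix₂)ⁿ, h_n = (n(n+d−1))^{−1/2}, E the equator {x₃ = ⋯ = x_{d+1} = 0},
d(x,E) = arccos|x₁+ix₂| the geodesic distance to E, and N_β = {d(x,E) < β}.
For fixed 0 < δ < 1/2 there are C₁, C₂, c > 0 with, for all large n,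
‖e_n‖_{L²(N_{h_n^δ})} ≥ C₁ h_n^{(d−1)/4} and
‖e_n‖_{L²(N_{2h_n^δ}∖N_{h_n^δ})} ≤ C₂ e^{−c h_n^{2δ−1}}. -/
theorem equator_concentration (d : ℕ) (hd : 1 ≤ d) (δ : ℝ) (hδ0 : 0 < δ) (hδ : δ < 1/2) :
    -- the surface measure on the unit sphere S^d ⊂ ℝ^{d+1}
    let σ : Measure (Metric.sphere (0 : EuclideanSpace ℝ (Fin (d+1))) 1) :=
      (volume : Measure (EuclideanSpace ℝ (Fin (d+1)))).toSphere
    -- geodesic distance on S^d to the equator E = {x₃ = ⋯ = x_{d+1} = 0}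
    let dE : Metric.sphere (0 : EuclideanSpace ℝ (Fin (d+1))) 1 → ℝ :=
      fun x => Real.arccos (Real.sqrt (((x : EuclideanSpace ℝ (Fin (d+1))) 0)^2 +
        ((x : EuclideanSpace ℝ (Fin (d+1))) 1)^2))
    let eFun : ℕ → Metric.sphere (0 : EuclideanSpace ℝ (Fin (d+1))) 1 → ℂ :=
      fun n x => (((x : EuclideanSpace ℝ (Fin (d+1))) 0 : ℝ) +
        Complex.I * ((x : EuclideanSpace ℝ (Fin (d+1))) 1 : ℝ))^n
    let hsc : ℕ → ℝ := fun n => ((n : ℝ) * ((n : ℝ) + (d : ℝ) - 1)) ^ (-(1/2 : ℝ))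
    ∃ C1 > (0:ℝ), ∃ C2 > (0:ℝ), ∃ c > (0:ℝ), ∃ N0 : ℕ, ∀ n ≥ N0,
      C1 * hsc n ^ (((d:ℝ) - 1)/4) ≤
          (∫ x in {x | dE x < hsc n ^ δ}, ‖eFun n x‖^2 ∂σ) ^ (1/2:ℝ) ∧
      (∫ x in {x | dE x < 2 * hsc n ^ δ} \ {x | dE x < hsc n ^ δ},
          ‖eFun n x‖^2 ∂σ) ^ (1/2:ℝ) ≤
        C2 * Real.exp (-c * hsc n ^ (2*δ - 1)) := by
  intro σ dE eFun hsc
  obtain ⟨m, rfl⟩ : ∃ m, d = m + 1 := ⟨d - 1, by omega⟩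
  obtain ⟨C, hC, hvol⟩ := exists_mul_pow_le_toSphere_real m
  have hr1 : ∀ x : Metric.sphere (0 : EuclideanSpace ℝ (Fin (m + 1 + 1))) 1,
      √((x : EuclideanSpace ℝ (Fin (m + 1 + 1))) 0 ^ 2 +
        (x : EuclideanSpace ℝ (Fin (m + 1 + 1))) 1 ^ 2) ≤ 1 := fun x =>
    (sqrt_sq_add_sq_le_norm _).trans (norm_eq_of_mem_sphere x).le
  have hnorm : ∀ n x, ‖eFun n x‖ ^ 2 = √((x : EuclideanSpace ℝ (Fin (m + 1 + 1))) 0 ^ 2 +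
      (x : EuclideanSpace ℝ (Fin (m + 1 + 1))) 1 ^ 2) ^ (2 * n) := by
    intro n x
    simp only [eFun]
    rw [norm_pow, mul_comm Complex.I, Complex.norm_add_mul_I, ← pow_mul, mul_comm n]
  have hint : ∀ n s, IntegrableOn (fun x => ‖eFun n x‖ ^ 2) s σ := by
    intro n s
    have hcont : Continuous fun x => ‖eFun n x‖ ^ 2 := by
      simp only [eFun]
      fun_prop
    refine Measure.integrableOn_of_bounded (M := 1) (measure_ne_top _ _)
      hcont.aestronglyMeasurable (Filter.Eventually.of_forall fun x => ?_)
    rw [hnorm, Real.norm_of_nonneg (by positivity)]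
    exact pow_le_one₀ (Real.sqrt_nonneg _) (hr1 x)
  refine ⟨(C / 4) ^ (1 / 2 : ℝ), by positivity, (σ.real Set.univ + 1) ^ (1 / 2 : ℝ),
    by positivity, 1 / (8 * ((m + 1 : ℕ) : ℝ)), by positivity, 1, fun n hn => ?_⟩
  obtain ⟨hh0, hhn, hnh⟩ := rpow_neg_half_bounds (d := m + 1) hn hd
  change 0 < hsc n at hh0
  change (n : ℝ) * hsc n ≤ 1 at hhn
  change 1 ≤ ((m + 1 : ℕ) : ℝ) * (n * hsc n) at hnh
  generalize hsc n = h at hh0 hhn hnh ⊢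
  have hn' : (1 : ℝ) ≤ n := by exact_mod_cast hn
  have hh1 : h ≤ 1 := by nlinarith
  constructor
  · have hε0 : 0 < h ^ (1 / 2 : ℝ) := by positivity
    have hε1 : h ^ (1 / 2 : ℝ) ≤ 1 := Real.rpow_le_one hh0.le hh1 (by norm_num)
    have hε2 : (h ^ (1 / 2 : ℝ)) ^ 2 = h := by
      rw [← Real.sqrt_eq_rpow, Real.sq_sqrt hh0.le]
    have hsub : {x | dE x < h ^ (1 / 2 : ℝ)} ⊆ {x | dE x < h ^ δ} := fun x hx =>
      lt_of_lt_of_le hx (Real.rpow_le_rpow_of_exponent_ge hh0 hh1 hδ.le)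
    have hlow : C / 4 * (h ^ (1 / 2 : ℝ)) ^ m ≤ ∫ x in {x | dE x < h ^ δ}, ‖eFun n x‖ ^ 2 ∂σ :=
      calc C / 4 * (h ^ (1 / 2 : ℝ)) ^ m = 1 / 4 * (C * (h ^ (1 / 2 : ℝ)) ^ m) := by ring
        _ ≤ 1 / 4 * σ.real {x | dE x < h ^ (1 / 2 : ℝ)} := by
          gcongr
          exact hvol _ hε0 hε1
        _ ≤ ∫ x in {x | dE x < h ^ (1 / 2 : ℝ)}, ‖eFun n x‖ ^ 2 ∂σ := by
          refine setIntegral_ge_of_const_le_real (measurableSet_arccos_lt _) (measure_ne_top _ _)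
            (fun x hx => ?_) (hint n _)
          rw [hnorm]
          exact one_fourth_le_pow_of_arccos_lt hn (Real.sqrt_nonneg _) (hr1 x)
            (by rwa [hε2]) hx
        _ ≤ ∫ x in {x | dE x < h ^ δ}, ‖eFun n x‖ ^ 2 ∂σ :=
          setIntegral_mono_set (hint n _) (Filter.Eventually.of_forall fun x => by positivity)
            hsub.eventuallyLE
    calc (C / 4) ^ (1 / 2 : ℝ) * h ^ ((((m + 1 : ℕ) : ℝ) - 1) / 4)
        = (C / 4 * (h ^ (1 / 2 : ℝ)) ^ m) ^ (1 / 2 : ℝ) := by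
          rw [Real.mul_rpow (by positivity) (by positivity), ← Real.rpow_mul_natCast hh0.le,
            ← Real.rpow_mul hh0.le]
          congr 2
          push_cast
          ring
      _ ≤ _ := Real.rpow_le_rpow (by positivity) hlow (by norm_num)
  · have hβ0 : 0 ≤ h ^ δ := by positivity
    have hβ1 : h ^ δ ≤ 1 := Real.rpow_le_one hh0.le hh1 hδ0.le
    set t := h ^ (2 * δ - 1) with ht
    have ht0 : 0 < t := by positivity
    have hth : (h ^ δ) ^ 2 = t * h := by
      rw [ht, ← Real.rpow_mul_natCast hh0.le, ← Real.rpow_add_one hh0.ne']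
      congr 1
      push_cast
      ring
    have hrate : 1 / (4 * ((m + 1 : ℕ) : ℝ)) * t ≤ n * (h ^ δ) ^ 2 / 4 := by
      rw [hth, one_div_mul_eq_div, div_le_div_iff₀ (by positivity) (by norm_num)]
      nlinarith
    have hup : ∫ x in {x | dE x < 2 * h ^ δ} \ {x | dE x < h ^ δ}, ‖eFun n x‖ ^ 2 ∂σ ≤
        (σ.real Set.univ + 1) * Real.exp (-(1 / (4 * ((m + 1 : ℕ) : ℝ)) * t)) := by
      refine (Real.le_norm_self _).trans ((norm_setIntegral_le_of_norm_le_const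
        (C := Real.exp (-(1 / (4 * ((m + 1 : ℕ) : ℝ)) * t))) (measure_lt_top _ _)
        fun x hx => ?_).trans ?_)
      · rw [hnorm, Real.norm_of_nonneg (by positivity)]
        refine (pow_le_exp_of_le_arccos n (Real.sqrt_nonneg _) (hr1 x) hβ0 hβ1
          (not_lt.1 hx.2)).trans ?_
        gcongr
      · rw [mul_comm]
        gcongr
        exact (measureReal_mono (Set.subset_univ _)).trans (by linarith)
    refine (Real.rpow_le_rpow (integral_nonneg fun x => by positivity) hup (by norm_num)).trans
      (le_of_eq ?_)
    rw [Real.mul_rpow (by positivity) (by positivity), ← Real.exp_mul]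
    congr 2
    field_simp
    norm_num
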